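/- Let H be a finite-dimensional vector space over 𝔽₂ with a nondegenerate symmetric bilinear form B. Then for every x ∈ H, the sum over all quadratic enhancements q on (H,B) of conj(T(q))·i^{q(x)} equals |H| (the cardinality of H), where conj denotes complex conjugation. -/

import Mathlib

/-- A quadratic enhancement of a bilinear form over `𝔽₂`. -/
def IsQuadraticEnhancement {H : Type*} [AddCommGroup H] [Module (ZMod 2) H]
    (B : H →ₗ[ZMod 2] H →ₗ[ZMod 2] ZMod 2) (q : H → ZMod 4) : Prop :=
  (∀ a, ZMod.castHom (show (2 : ℕ) ∣ 4 by norm_num) (ZMod 2) (q a) = B a a) ∧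
    ∀ a b, q (a + b) = q a + q b + 2 * ((B a b).val : ZMod 4)

theorem two_mul_val_add (a b : ZMod 2) :
    2 * ((a + b).val : ZMod 4) = 2 * (a.val : ZMod 4) + 2 * (b.val : ZMod 4) := by
  decide +revert

theorem castHom_two_mul (a : ZMod 4) :
    ZMod.castHom (show (2 : ℕ) ∣ 4 by norm_num) (ZMod 2) (2 * a) = 0 := by
  decide +revert

theorem castHom_natCast_val (a : ZMod 2) :
    ZMod.castHom (show (2 : ℕ) ∣ 4 by norm_num) (ZMod 2) (a.val : ZMod 4) = a := by
  decide +revert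

theorem two_mul_val_castHom (a : ZMod 4) :
    2 * ((ZMod.castHom (show (2 : ℕ) ∣ 4 by norm_num) (ZMod 2) a).val : ZMod 4) = 2 * a := by
  decide +revert

theorem two_mul_val_injective :
    Function.Injective fun a : ZMod 2 => 2 * (a.val : ZMod 4) := by
  intro a b
  decide +revert

theorem exists_two_mul_val_eq_of_castHom_eq (a b : ZMod 4)
    (h : ZMod.castHom (show (2 : ℕ) ∣ 4 by norm_num) (ZMod 2) a =
      ZMod.castHom (show (2 : ℕ) ∣ 4 by norm_num) (ZMod 2) b) :
    ∃ c : ZMod 2, a = b + 2 * (c.val : ZMod 4) := by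
  decide +revert

theorem I_pow_val_add (a b : ZMod 4) :
    Complex.I ^ (a + b).val = Complex.I ^ a.val * Complex.I ^ b.val := by
  rw [ZMod.val_add, ← Complex.I_pow_eq_pow_mod, pow_add]

theorem conj_I_pow_mul_I_pow (n : ℕ) :
    (starRingEnd ℂ) (Complex.I ^ n) * Complex.I ^ n = 1 := by
  rw [map_pow, ← mul_pow]
  simp

theorem I_pow_two_mul_val (a : ZMod 2) :
    Complex.I ^ (2 * (a.val : ZMod 4)).val = (-1) ^ a.val := by
  have h : (2 * (a.val : ZMod 4)).val = 2 * a.val := by decide +revert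
  rw [h, pow_mul, Complex.I_sq]

theorem neg_one_pow_val_add (a b : ZMod 2) :
    (-1 : ℂ) ^ (a + b).val = (-1) ^ a.val * (-1) ^ b.val := by
  rw [ZMod.val_add, ← neg_one_pow_eq_pow_mod_two, pow_add]

section

variable {H : Type*} [AddCommGroup H] [Module (ZMod 2) H]
  {B : H →ₗ[ZMod 2] H →ₗ[ZMod 2] ZMod 2}

theorem exists_isQuadraticEnhancement [Finite H] (hsymm : ∀ x y, B x y = B y x) :
    ∃ q, IsQuadraticEnhancement B q := by
  let b := Module.finBasis (ZMod 2) H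
  let M : Matrix _ _ (ZMod 4) := Matrix.of fun i j => ((B (b i) (b j)).val : ZMod 4)
  let β := Matrix.toBilin' M
  let s : H → Fin (Module.finrank (ZMod 2) H) → ZMod 4 := fun x i => ((b.repr x i).val : ZMod 4)
  have hβ : ∀ v w, β v w = β w v := by
    intro v w
    simp only [β, Matrix.toBilin'_apply]
    rw [Finset.sum_comm]
    refine Finset.sum_congr rfl fun i _ => Finset.sum_congr rfl fun j _ => ?_
    simp only [M, Matrix.of_apply, hsymm (b i) (b j)]
    ring
  have hs : ∀ x y, s (x + y) = s x + s y + (2 : ZMod 4) • (s x * s y) := by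
    intro x y
    ext i
    simp only [s, map_add, Finsupp.add_apply, Pi.add_apply, Pi.smul_apply, Pi.mul_apply,
      smul_eq_mul]
    generalize b.repr x i = c
    generalize b.repr y i = d
    decide +revert
  have hred : ∀ x y,
      ZMod.castHom (show (2 : ℕ) ∣ 4 by norm_num) (ZMod 2) (β (s x) (s y)) = B x y := by
    intro x y
    simp only [β, Matrix.toBilin'_apply, map_sum, map_mul, M, s, Matrix.of_apply,
      castHom_natCast_val]
    conv_rhs => rw [← b.sum_repr x, ← b.sum_repr y]
    simp only [map_sum, map_smul, LinearMap.sum_apply, LinearMap.smul_apply, smul_eq_mul,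
      Finset.mul_sum]
    rw [Finset.sum_comm]
    refine Finset.sum_congr rfl fun i _ => Finset.sum_congr rfl fun j _ => ?_
    ring
  refine ⟨fun x => β (s x) (s x), fun x => hred x x, fun x y => ?_⟩
  have h4 : (4 : ZMod 4) = 0 := rfl
  rw [← hred x y, two_mul_val_castHom]
  beta_reduce
  rw [hs]
  simp only [map_add, map_smul, LinearMap.add_apply, LinearMap.smul_apply, smul_eq_mul]
  rw [hβ (s y) (s x), hβ (s x * s y) (s x), hβ (s x * s y) (s y)]
  linear_combination (β (s x) (s x * s y) + β (s y) (s x * s y) +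
    β (s x * s y) (s x * s y)) * h4

theorem IsQuadraticEnhancement.add_two_mul {q : H → ZMod 4} (hq : IsQuadraticEnhancement B q)
    (c : H) : IsQuadraticEnhancement B fun x => q x + 2 * ((B c x).val : ZMod 4) := by
  refine ⟨fun a => ?_, fun a b => ?_⟩
  · rw [map_add, castHom_two_mul, add_zero, hq.1]
  · simp only [hq.2, map_add, two_mul_val_add]
    ring

theorem bijective_of_nondegenerate [Finite H] (hnd : ∀ x, (∀ y, B x y = 0) → x = 0) :
    Function.Bijective B := by
  have hinj : Function.Injective B :=
    (injective_iff_map_eq_zero B).2 fun x hx => hnd x fun y => by rw [hx, LinearMap.zero_apply]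
  exact ⟨hinj, (LinearMap.injective_iff_surjective_of_finrank_eq_finrank
    Subspace.dual_finrank_eq.symm).1 hinj⟩

theorem IsQuadraticEnhancement.exists_eq_add_two_mul [Finite H]
    (hnd : ∀ x, (∀ y, B x y = 0) → x = 0) {q q' : H → ZMod 4}
    (hq : IsQuadraticEnhancement B q) (hq' : IsQuadraticEnhancement B q') :
    ∃ c, q' = fun x => q x + 2 * ((B c x).val : ZMod 4) := by
  choose f hf using fun x =>
    exists_two_mul_val_eq_of_castHom_eq (q' x) (q x) ((hq'.1 x).trans (hq.1 x).symm)
  have hadd : ∀ x y, f (x + y) = f x + f y := by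
    intro x y
    apply two_mul_val_injective
    have h := hq'.2 x y
    rw [hf, hf x, hf y, hq.2] at h
    simp only [two_mul_val_add]
    linear_combination h
  obtain ⟨c, hc⟩ := (bijective_of_nondegenerate hnd).2
    ((AddMonoidHom.mk' f hadd).toZModLinearMap 2)
  refine ⟨c, funext fun x => ?_⟩
  rw [hf, hc]
  rfl

theorem sum_neg_one_pow_val_eq_zero [Fintype H] (hsymm : ∀ x y, B x y = B y x)
    (hnd : ∀ x, (∀ y, B x y = 0) → x = 0) {z : H} (hz : z ≠ 0) :
    ∑ c, (-1 : ℂ) ^ (B c z).val = 0 := by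
  obtain ⟨d, hd⟩ : ∃ d, B z d ≠ 0 := by
    by_contra! h
    exact hz (hnd z h)
  have hd1 : B d z = 1 := by
    rw [hsymm]
    exact Fin.eq_one_of_ne_zero _ hd
  have h := Equiv.sum_comp (Equiv.addRight d) fun c => (-1 : ℂ) ^ (B c z).val
  simp only [Equiv.coe_addRight, map_add, LinearMap.add_apply, neg_one_pow_val_add, hd1,
    ZMod.val_one, pow_one, mul_neg, mul_one, Finset.sum_neg_distrib] at h
  exact self_eq_neg.1 h.symm

theorem conj_mul_I_pow_add_two_mul (q : H → ZMod 4) (c x y : H) :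
    (starRingEnd ℂ) (Complex.I ^ (q y + 2 * ((B c y).val : ZMod 4)).val) *
        Complex.I ^ (q x + 2 * ((B c x).val : ZMod 4)).val =
      (starRingEnd ℂ) (Complex.I ^ (q y).val) * Complex.I ^ (q x).val *
        (-1) ^ (B c (y + x)).val := by
  simp only [I_pow_val_add, I_pow_two_mul_val, map_add, neg_one_pow_val_add, map_mul, map_pow,
    map_neg, map_one]
  ring

end


/-- Let `H` be a finite-dimensional vector space over `𝔽₂` with a nondegenerate symmetric
bilinear form `B`.  A quadratic enhancement on `(H,B)` is `q : H → ℤ/4` with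
`q(x) ≡ B(x,x) (mod 2)` and `q(x+y) = q(x) + q(y) + 2·B(x,y)`.  Then for every `x ∈ H`,
the sum over all quadratic enhancements `q` of `conj(T(q))·i^{q(x)}` equals `|H|`, where
`T(q) = Σ_y i^{q(y)}` is the complex Gauss sum of `q`. -/
theorem sum_conj_gauss_mul_i_pow_eq_card
    (H : Type) [AddCommGroup H] [Module (ZMod 2) H] [Fintype H] [DecidableEq H]
    (B : H →ₗ[ZMod 2] H →ₗ[ZMod 2] ZMod 2)
    (hsymm : ∀ x y, B x y = B y x)
    (hnd : ∀ x, (∀ y, B x y = 0) → x = 0)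
    (x : H) :
    ∑ q ∈ Finset.univ.filter
        (fun q : H → ZMod 4 =>
          (∀ a, ZMod.castHom (show (2 : ℕ) ∣ 4 by norm_num) (ZMod 2) (q a) = B a a) ∧
          (∀ a b, q (a + b) = q a + q b + 2 * ((B a b).val : ZMod 4))),
      (starRingEnd ℂ) (∑ y, Complex.I ^ (q y).val) * Complex.I ^ (q x).val
      = Fintype.card H := by
  obtain ⟨q, hq⟩ := exists_isQuadraticEnhancement hsymm
  let e : H → H → ZMod 4 := fun c y => q y + 2 * ((B c y).val : ZMod 4)
  refine (Finset.sum_bij (s := Finset.univ)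
    (f := fun c => (starRingEnd ℂ) (∑ y, Complex.I ^ (e c y).val) * Complex.I ^ (e c x).val)
    (fun c _ => e c) ?_ ?_ ?_ fun c _ => rfl).symm.trans ?_
  · intro c _
    rw [Finset.mem_filter]
    exact ⟨Finset.mem_univ _, hq.add_two_mul c⟩
  · intro c _ d _ h
    refine (bijective_of_nondegenerate hnd).1 (LinearMap.ext fun y => ?_)
    exact two_mul_val_injective (add_left_cancel (congrFun h y))
  · intro q' hq'
    rw [Finset.mem_filter] at hq'
    obtain ⟨c, hc⟩ := hq.exists_eq_add_two_mul hnd hq'.2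
    exact ⟨c, Finset.mem_univ c, hc.symm⟩
  · simp only [e, map_sum, Finset.sum_mul, conj_mul_I_pow_add_two_mul]
    rw [Finset.sum_comm, Finset.sum_eq_single x]
    · simp only [conj_I_pow_mul_I_pow, ZModModule.add_self]
      simp
    · intro y _ hy
      rw [← Finset.mul_sum, sum_neg_one_pow_val_eq_zero hsymm hnd, mul_zero]
      rw [← ZModModule.sub_eq_add]
      exact sub_ne_zero.2 hy
    · simp
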